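/- For all integers n > d ≥ 1, A(n,d) ≥ (d²/(e·n²))^d · n^(n−d), where e is Euler's constant. In particular, if additionally d ≥ 2√n, then A(n,d) ≥ (4/e)^d · n^(n−2d). -/

import Mathlib

/-- The tree-distance between two spanning trees on `Fin n`:
`d(T₁,T₂) = n - 1 - |E₁ ∩ E₂|`. -/
noncomputable def treeDist {n : ℕ} (G H : SimpleGraph (Fin n)) : ℕ :=
  n - 1 - (G.edgeSet ∩ H.edgeSet).ncard

/-- An `(n,d)` tree-code: a finite set of (spanning) trees on `Fin n`
such that any two distinct members have tree-distance at least `d`. -/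
def IsTreeCode (n d : ℕ) (C : Finset (SimpleGraph (Fin n))) : Prop :=
  (∀ G ∈ C, G.IsTree) ∧ ∀ G ∈ C, ∀ H ∈ C, G ≠ H → d ≤ treeDist G H

/-- `A n d`: the maximum size of an `(n,d)` tree-code. -/
noncomputable def A (n d : ℕ) : ℕ :=
  sSup {m : ℕ | ∃ C : Finset (SimpleGraph (Fin n)), IsTreeCode n d C ∧ C.card = m}

/-- An `(n,d;i)` tree-code: an `(n,d)` tree-code all of whose trees contain
a common set of at least `i` edges. -/
def IsTreeCodeCommon (n d i : ℕ) (C : Finset (SimpleGraph (Fin n))) : Prop :=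
  IsTreeCode n d C ∧
    ∃ E : Finset (Sym2 (Fin n)), i ≤ E.card ∧ ∀ G ∈ C, (E : Set (Sym2 (Fin n))) ⊆ G.edgeSet

/-- `Acommon n d i`: the maximum size of an `(n,d;i)` tree-code. -/
noncomputable def Acommon (n d i : ℕ) : ℕ :=
  sSup {m : ℕ | ∃ C : Finset (SimpleGraph (Fin n)), IsTreeCodeCommon n d i C ∧ C.card = m}

namespace SimpleGraph

variable {V : Type*}

theorem reachable_sup_edge_iff (G : SimpleGraph V) {u v : V} (x y : V) :
    (G ⊔ edge u v).Reachable x y ↔ G.Reachable x y ∨ (G.Reachable x u ∧ G.Reachable v y) ∨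
      (G.Reachable x v ∧ G.Reachable u y) := by
  constructor
  · rintro ⟨p⟩
    induction p with
    | nil => exact .inl .rfl
    | @cons a b c hab p ih =>
      rw [sup_adj, edge_adj] at hab
      rcases hab with hab | ⟨⟨rfl, rfl⟩ | ⟨rfl, rfl⟩, hne⟩
      · rcases ih with ih | ⟨h₁, h₂⟩ | ⟨h₁, h₂⟩
        · exact .inl (hab.reachable.trans ih)
        · exact .inr (.inl ⟨hab.reachable.trans h₁, h₂⟩)
        · exact .inr (.inr ⟨hab.reachable.trans h₁, h₂⟩)
      · rcases ih with ih | ⟨h₁, h₂⟩ | ⟨h₁, h₂⟩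
        · exact .inr (.inl ⟨.rfl, ih⟩)
        · exact .inr (.inl ⟨.rfl, h₂⟩)
        · exact .inl h₂
      · rcases ih with ih | ⟨h₁, h₂⟩ | ⟨h₁, h₂⟩
        · exact .inr (.inr ⟨.rfl, ih⟩)
        · exact .inl h₂
        · exact .inr (.inr ⟨.rfl, h₂⟩)
  · have huv : (G ⊔ edge u v).Reachable u v := by
      by_cases h : u = v
      · exact h ▸ .rfl
      · exact Adj.reachable (by simp [edge_adj, h])
    have mono {a b : V} (h : G.Reachable a b) : (G ⊔ edge u v).Reachable a b :=
      h.mono le_sup_left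
    rintro (h | ⟨h₁, h₂⟩ | ⟨h₁, h₂⟩)
    · exact mono h
    · exact ((mono h₁).trans huv).trans (mono h₂)
    · exact ((mono h₁).trans huv.symm).trans (mono h₂)

section Finite

open scoped Classical

variable [Fintype V]

/-- The number of vertices in the connected component of `v`. -/
noncomputable def componentSize (G : SimpleGraph V) (v : V) : ℕ :=
  (G.connectedComponentMk v).supp.ncard

/-- The product of the sizes of the connected components. -/
noncomputable def componentProd (G : SimpleGraph V) : ℕ :=
  ∏ c : G.ConnectedComponent, c.supp.ncard

theorem componentProd_eq_prod (G : SimpleGraph V) [Fintype G.ConnectedComponent] :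
    G.componentProd = ∏ c : G.ConnectedComponent, c.supp.ncard := by
  rw [componentProd]
  congr!

theorem componentSize_pos (G : SimpleGraph V) (v : V) : 0 < G.componentSize v :=
  (Set.ncard_pos).2 ⟨v, rfl⟩

theorem componentSize_eq_card (G : SimpleGraph V) (v : V) :
    G.componentSize v = (Finset.univ.filter fun w => G.Reachable v w).card := by
  rw [componentSize, ← Set.ncard_coe_finset]
  congr 1
  ext w
  simp [ConnectedComponent.eq, reachable_comm]

/-- Adding an edge between two components merges them: the components of the new graph correspond
to the old ones other than that of `u`. -/
theorem exists_equiv_connectedComponent_sup_edge {G : SimpleGraph V} {u v : V}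
    (huv : ¬ G.Reachable u v) :
    ∃ e : {c : G.ConnectedComponent // c ≠ G.connectedComponentMk u} ≃
        (G ⊔ edge u v).ConnectedComponent,
      ∀ c, (e c).supp.ncard = if c.1 = G.connectedComponentMk v then
        G.componentSize u + G.componentSize v else c.1.supp.ncard := by
  let f : {c : G.ConnectedComponent // c ≠ G.connectedComponentMk u} →
        (G ⊔ edge u v).ConnectedComponent :=
    fun c => c.1.map (Hom.ofLE le_sup_left)
  have hf : Function.Bijective f := by
    constructor
    · rintro ⟨c, hc⟩ ⟨c', hc'⟩ h
      induction c using ConnectedComponent.ind with | _ x =>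
      induction c' using ConnectedComponent.ind with | _ y =>
      simp only [f, ConnectedComponent.map_mk, ConnectedComponent.eq, Subtype.mk.injEq,
        Hom.coe_ofLE, id_eq] at h ⊢
      rw [ne_eq, ConnectedComponent.eq] at hc hc'
      rcases (reachable_sup_edge_iff G x y).1 h with h | h | h
      · exact h
      · exact (hc h.1).elim
      · exact (hc' h.2.symm).elim
    · intro c
      induction c using ConnectedComponent.ind with | _ x =>
      by_cases hx : G.Reachable x u
      · refine ⟨⟨G.connectedComponentMk v, ?_⟩, ?_⟩
        · simpa [ConnectedComponent.eq, reachable_comm] using huv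
        · simp only [f, ConnectedComponent.map_mk, ConnectedComponent.eq, Hom.coe_ofLE, id_eq]
          rw [reachable_sup_edge_iff]
          exact .inr (.inr ⟨.rfl, hx.symm⟩)
      · refine ⟨⟨G.connectedComponentMk x, ?_⟩, rfl⟩
        simpa [ConnectedComponent.eq] using hx
  refine ⟨Equiv.ofBijective f hf, ?_⟩
  rintro ⟨c, hc⟩
  induction c using ConnectedComponent.ind with | _ x =>
  simp only [Equiv.ofBijective_apply, f, ConnectedComponent.map_mk, Hom.coe_ofLE, id_eq]
  rw [ne_eq, ConnectedComponent.eq] at hc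
  split_ifs with h
  · rw [ConnectedComponent.eq] at h
    rw [componentSize, componentSize, ← Set.ncard_union_eq]
    · congr 1
      ext y
      simp only [ConnectedComponent.mem_supp_iff, Set.mem_union, ConnectedComponent.eq,
        reachable_sup_edge_iff]
      have := h.symm
      constructor
      · rintro (h' | h' | h')
        · exact .inr (h'.trans h)
        · exact .inl h'.1
        · exact .inr h'.1
      · rintro (h' | h')
        · exact .inr (.inl ⟨h', this⟩)
        · exact .inl (h'.trans this)
    · rw [Set.disjoint_left]
      intro y hy hy'
      simp only [ConnectedComponent.mem_supp_iff, ConnectedComponent.eq] at hy hy'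
      exact huv (hy.symm.trans hy')
  · rw [ConnectedComponent.eq] at h
    congr 1
    ext y
    simp only [ConnectedComponent.mem_supp_iff, ConnectedComponent.eq, reachable_sup_edge_iff]
    constructor
    · rintro (h' | h' | h')
      · exact h'
      · exact (h h'.2.symm).elim
      · exact (hc h'.2.symm).elim
    · exact .inl

theorem card_connectedComponent_sup_edge {G : SimpleGraph V} {u v : V}
    (huv : ¬ G.Reachable u v) :
    Nat.card (G ⊔ edge u v).ConnectedComponent + 1 = Nat.card G.ConnectedComponent := by
  obtain ⟨e, -⟩ := exists_equiv_connectedComponent_sup_edge huv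
  have : 0 < Nat.card G.ConnectedComponent :=
    Nat.card_pos_iff.2 ⟨⟨G.connectedComponentMk u⟩, inferInstance⟩
  rw [← Nat.card_congr e]
  simp only [Nat.card_eq_fintype_card, Fintype.card_subtype_compl, Fintype.card_subtype_eq] at *
  omega

theorem componentProd_sup_edge {G : SimpleGraph V} {u v : V} (huv : ¬ G.Reachable u v) :
    (G ⊔ edge u v).componentProd * (G.componentSize u * G.componentSize v) =
      G.componentProd * (G.componentSize u + G.componentSize v) := by
  obtain ⟨e, he⟩ := exists_equiv_connectedComponent_sup_edge huv
  have hne : G.connectedComponentMk v ≠ G.connectedComponentMk u := by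
    simpa [ConnectedComponent.eq, reachable_comm] using huv
  have hmem : G.connectedComponentMk v ∈ Finset.univ.erase (G.connectedComponentMk u) := by
    simpa using hne
  have h₁ : (G ⊔ edge u v).componentProd = (G.componentSize u + G.componentSize v) *
      ∏ c ∈ (Finset.univ.erase (G.connectedComponentMk u)).erase (G.connectedComponentMk v),
        c.supp.ncard := by
    rw [componentProd_eq_prod, ← e.prod_comp]
    simp only [he]
    rw [← Finset.prod_subtype (Finset.univ.erase (G.connectedComponentMk u)) (by simp)
      (fun c => if c = G.connectedComponentMk v then
        G.componentSize u + G.componentSize v else c.supp.ncard),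
      ← Finset.mul_prod_erase _ _ hmem, if_pos rfl]
    congr 1
    exact Finset.prod_congr rfl fun c hc => if_neg (Finset.ne_of_mem_erase hc)
  have h₂ : G.componentProd = G.componentSize u * (G.componentSize v *
      ∏ c ∈ (Finset.univ.erase (G.connectedComponentMk u)).erase (G.connectedComponentMk v),
        c.supp.ncard) := by
    rw [componentProd, ← Finset.mul_prod_erase _ _ (Finset.mem_univ (G.connectedComponentMk u)),
      ← Finset.mul_prod_erase _ _ hmem]
    rfl
  rw [h₁, h₂]
  ring

theorem IsAcyclic.ncard_edgeSet_add_card_connectedComponent {G : SimpleGraph V}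
    (hG : G.IsAcyclic) :
    G.edgeSet.ncard + Nat.card G.ConnectedComponent = Fintype.card V := by
  induction hk : Nat.card G.ConnectedComponent generalizing G with
  | zero =>
    have : IsEmpty V := by
      rw [Finite.card_eq_zero_iff] at hk
      exact ⟨fun v => hk.false (G.connectedComponentMk v)⟩
    have : IsEmpty (Sym2 V) := ⟨fun e => e.ind fun a _ => this.false a⟩
    simp [Set.eq_empty_of_isEmpty]
  | succ k ih =>
    by_cases hc : G.Preconnected
    · have : Nonempty V := by
        by_contra h
        rw [not_nonempty_iff] at h
        have : IsEmpty G.ConnectedComponent := ⟨fun c => c.ind fun v => h.false v⟩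
        simp at hk
      have htree : G.IsTree := ⟨⟨hc⟩, hG⟩
      have h := htree.card_edgeFinset
      have hsub := hc.subsingleton_connectedComponent
      have : Nat.card G.ConnectedComponent ≤ 1 := Finite.card_le_one_iff_subsingleton.2 hsub
      rw [Set.ncard_eq_toFinset_card']
      simp only [edgeFinset] at h
      omega
    · simp only [Preconnected, not_forall] at hc
      obtain ⟨u, v, huv⟩ := hc
      have hcard := card_connectedComponent_sup_edge huv
      have hne : u ≠ v := fun h => huv (h ▸ .rfl)
      have := ih (hG.sup_edge_of_not_reachable huv) (by omega)
      rw [edgeSet_sup, edgeSet_edge_of_ne hne, Set.union_singleton,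
        Set.ncard_insert_of_notMem] at this
      · omega
      · exact fun h => huv (Adj.reachable h)

theorem sum_componentSize_inv (G : SimpleGraph V) :
    ∑ v, (1 / G.componentSize v : ℝ) = Nat.card G.ConnectedComponent := by
  rw [← Finset.sum_fiberwise Finset.univ G.connectedComponentMk, Nat.card_eq_fintype_card,
    Fintype.card_eq_sum_ones, Nat.cast_sum]
  refine Finset.sum_congr rfl fun c _ => ?_
  induction c using ConnectedComponent.ind with | _ x =>
  have hx : (0 : ℝ) < G.componentSize x := mod_cast G.componentSize_pos x
  rw [Finset.sum_congr rfl (g := fun _ => (1 / G.componentSize x : ℝ))]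
  · rw [Finset.sum_const, nsmul_eq_mul]
    have : (Finset.univ.filter fun i => G.connectedComponentMk i = G.connectedComponentMk x).card
        = G.componentSize x := by
      rw [componentSize_eq_card]
      congr 1
      ext w
      simp [ConnectedComponent.eq, reachable_comm]
    rw [this]
    field_simp
    simp
  · intro i hi
    simp only [Finset.mem_filter, Finset.mem_univ, true_and] at hi
    rw [componentSize, hi, componentSize]

theorem sum_not_reachable_inv_componentSize (G : SimpleGraph V) :
    ∑ p : V × V with ¬ G.Reachable p.1 p.2,
        (1 / G.componentSize p.1 + 1 / G.componentSize p.2 : ℝ) =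
      2 * Fintype.card V * (Nat.card G.ConnectedComponent - 1) := by
  have h₁ : ∑ p : V × V with ¬ G.Reachable p.1 p.2, (1 / G.componentSize p.1 : ℝ) =
      Fintype.card V * (Nat.card G.ConnectedComponent - 1) := by
    rw [Finset.sum_filter, Fintype.sum_prod_type, ← sum_componentSize_inv, mul_sub,
      Finset.mul_sum, mul_one, Fintype.card_eq_sum_ones, Nat.cast_sum, ← Finset.sum_sub_distrib]
    refine Finset.sum_congr rfl fun x _ => ?_
    have hx : (0 : ℝ) < G.componentSize x := mod_cast G.componentSize_pos x
    simp only [← Finset.sum_filter, Finset.sum_const, nsmul_eq_mul]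
    have := Finset.card_filter_add_card_filter_not (s := (Finset.univ : Finset V))
      (fun w => G.Reachable x w)
    rw [← componentSize_eq_card] at this
    have h : ((Finset.univ.filter fun w => ¬ G.Reachable x w).card : ℝ) =
        Fintype.card V - G.componentSize x := by
      rw [eq_sub_iff_add_eq', ← Finset.card_univ]
      exact_mod_cast this
    rw [h]
    field_simp
    simp
  have h₂ : ∑ p : V × V with ¬ G.Reachable p.1 p.2, (1 / G.componentSize p.2 : ℝ) =
      ∑ p : V × V with ¬ G.Reachable p.1 p.2, (1 / G.componentSize p.1 : ℝ) := by
    refine Finset.sum_equiv (Equiv.prodComm V V) ?_ ?_ <;> simp [reachable_comm]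
  rw [Finset.sum_add_distrib, h₂, h₁]
  ring

theorem card_adj_pairs (G : SimpleGraph V) :
    (Finset.univ.filter fun p : V × V => G.Adj p.1 p.2).card = 2 * G.edgeSet.ncard := by
  rw [Set.ncard_eq_toFinset_card', ← edgeFinset, ← sum_degrees_eq_twice_card_edges,
    Finset.card_filter, Fintype.sum_prod_type]
  refine Finset.sum_congr rfl fun x _ => ?_
  rw [← Finset.card_filter, ← card_neighborFinset_eq_degree]
  congr 1
  ext; simp

/-- The spanning trees that contain the graph `F`. -/
noncomputable def treesAbove (F : SimpleGraph V) : Finset (SimpleGraph V) :=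
  Finset.univ.filter fun T => T.IsTree ∧ F ≤ T

theorem mem_treesAbove {F T : SimpleGraph V} : T ∈ F.treesAbove ↔ T.IsTree ∧ F ≤ T := by
  simp [treesAbove]

theorem IsTree.card_adj_not_reachable {F T : SimpleGraph V} (hT : T.IsTree) (hF : F ≤ T) :
    (Finset.univ.filter fun p : V × V => T.Adj p.1 p.2 ∧ ¬ F.Reachable p.1 p.2).card + 2 =
      2 * Nat.card F.ConnectedComponent := by
  have hiff (p : V × V) : (T.Adj p.1 p.2 ∧ ¬ F.Reachable p.1 p.2) ↔
      (T.Adj p.1 p.2 ∧ ¬ F.Adj p.1 p.2) := by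
    refine and_congr_right fun hp => not_congr ⟨fun hr => ?_, fun h => h.reachable⟩
    by_contra hnot
    have hb := isAcyclic_iff_forall_adj_isBridge.1 hT.isAcyclic hp
    rw [isBridge_iff] at hb
    refine hb (hr.mono fun a b hab => ?_)
    rw [deleteEdges_adj]
    refine ⟨hF hab, fun h => hnot ?_⟩
    rw [← mem_edgeSet] at hab ⊢
    rw [Set.mem_singleton_iff] at h
    exact h ▸ hab
  have hsplit := Finset.card_filter_add_card_filter_not
    (s := Finset.univ.filter fun p : V × V => T.Adj p.1 p.2) (fun p => F.Adj p.1 p.2)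
  rw [Finset.filter_filter, Finset.filter_filter, card_adj_pairs] at hsplit
  simp only [hiff]
  have hFT (p : V × V) : (T.Adj p.1 p.2 ∧ F.Adj p.1 p.2) ↔ F.Adj p.1 p.2 :=
    and_iff_right_of_imp fun h => hF h
  simp only [hFT] at hsplit
  rw [card_adj_pairs] at hsplit
  have h₁ := (hT.isAcyclic.anti hF).ncard_edgeSet_add_card_connectedComponent
  have h₂ := hT.card_edgeFinset
  rw [edgeFinset, ← Set.ncard_eq_toFinset_card'] at h₂
  omega

theorem sum_card_treesAbove_sup_edge (F : SimpleGraph V) :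
    ∑ p : V × V with ¬ F.Reachable p.1 p.2, ((F ⊔ edge p.1 p.2).treesAbove.card : ℝ) =
      2 * (Nat.card F.ConnectedComponent - 1) * F.treesAbove.card := by
  have key : ∑ p : V × V with ¬ F.Reachable p.1 p.2, (F ⊔ edge p.1 p.2).treesAbove.card =
      ∑ T ∈ F.treesAbove,
        (Finset.univ.filter fun p : V × V => T.Adj p.1 p.2 ∧ ¬ F.Reachable p.1 p.2).card := by
    simp only [Finset.card_eq_sum_ones]
    refine Finset.sum_comm' fun p T => ?_
    simp only [Finset.mem_filter, Finset.mem_univ, true_and, mem_treesAbove, sup_le_iff]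
    constructor
    · rintro ⟨h, hT, hF, he⟩
      have hne : p.1 ≠ p.2 := fun h' => h (h' ▸ .rfl)
      exact ⟨⟨he (by simp [edge_adj, hne]), h⟩, hT, hF⟩
    · rintro ⟨⟨ha, h⟩, hT, hF⟩
      exact ⟨h, hT, hF, (edge_le_iff T).2 (.inr ha)⟩
  rw [← Nat.cast_sum, key, Nat.cast_sum, Finset.sum_congr rfl
    (g := fun _ => (2 * (Nat.card F.ConnectedComponent - 1) : ℝ)), Finset.sum_const, nsmul_eq_mul]
  · ring
  · intro T hT
    rw [mem_treesAbove] at hT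
    have := hT.1.card_adj_not_reachable hT.2
    rw [mul_sub, mul_one, eq_sub_iff_add_eq]
    exact_mod_cast this

/-- A forest on `n` vertices with components of sizes `c₁, …, c_k` lies in
`n ^ (k - 2) * c₁ * ⋯ * c_k` spanning trees. -/
theorem IsAcyclic.sq_mul_card_treesAbove [Nonempty V] {F : SimpleGraph V} (hF : F.IsAcyclic) :
    (Fintype.card V : ℝ) ^ 2 * F.treesAbove.card =
      (Fintype.card V : ℝ) ^ Nat.card F.ConnectedComponent * F.componentProd := by
  have hn : (0 : ℝ) < Fintype.card V := mod_cast Fintype.card_pos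
  obtain ⟨k, hk⟩ : ∃ k, Nat.card F.ConnectedComponent = k + 1 :=
    Nat.exists_eq_succ_of_ne_zero Nat.card_pos.ne'
  induction k generalizing F with
  | zero =>
    have hsub : Subsingleton F.ConnectedComponent :=
      Finite.card_le_one_iff_subsingleton.1 hk.le
    have htree : F.IsTree :=
      ⟨⟨fun u v => ConnectedComponent.exact (Subsingleton.elim _ _)⟩, hF⟩
    have h₁ : F.treesAbove = {F} := by
      ext T
      rw [mem_treesAbove, Finset.mem_singleton]
      refine ⟨fun ⟨hT, hle⟩ => ?_, ?_⟩
      swap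
      · rintro rfl
        exact ⟨htree, le_rfl⟩
      exact le_antisymm ((isTree_iff_minimal_connected.1 hT).2 htree.connected hle) hle
    have h₂ : F.componentProd = Fintype.card V := by
      let v : V := Classical.arbitrary V
      rw [componentProd, Fintype.prod_subsingleton _ (F.connectedComponentMk v)]
      change F.componentSize v = _
      rw [componentSize_eq_card, Finset.filter_true_of_mem, Finset.card_univ]
      exact fun w _ => htree.connected.preconnected v w
    rw [h₁, h₂, hk]
    simp [sq]
  | succ k ih =>
    have hsum := F.sum_card_treesAbove_sup_edge
    have hterm (p : V × V) (hp : ¬ F.Reachable p.1 p.2) :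
        (Fintype.card V : ℝ) ^ 2 * (F ⊔ edge p.1 p.2).treesAbove.card =
          (Fintype.card V : ℝ) ^ (k + 1) * F.componentProd *
            (1 / F.componentSize p.1 + 1 / F.componentSize p.2) := by
      have hcard := card_connectedComponent_sup_edge hp
      have hk' : Nat.card (F ⊔ edge p.1 p.2).ConnectedComponent = k + 1 := by omega
      rw [ih (hF.sup_edge_of_not_reachable hp) hk', hk']
      have h₁ : (0 : ℝ) < F.componentSize p.1 := mod_cast F.componentSize_pos _
      have h₂ : (0 : ℝ) < F.componentSize p.2 := mod_cast F.componentSize_pos _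
      have := congrArg (Nat.cast : ℕ → ℝ) (componentProd_sup_edge hp)
      push_cast at this
      rw [mul_assoc]
      congr 1
      field_simp
      linarith
    have hweighted : (Fintype.card V : ℝ) ^ 2 *
        (2 * (Nat.card F.ConnectedComponent - 1) * F.treesAbove.card) =
        (Fintype.card V : ℝ) ^ (k + 1) * F.componentProd *
          (2 * Fintype.card V * (Nat.card F.ConnectedComponent - 1)) := by
      rw [← hsum, ← sum_not_reachable_inv_componentSize, Finset.mul_sum, Finset.mul_sum]
      exact Finset.sum_congr rfl fun p hp => hterm p (Finset.mem_filter.1 hp).2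
    rw [hk] at hweighted ⊢
    push_cast at hweighted
    have hk0 : (0 : ℝ) < k + 1 := by positivity
    refine mul_left_cancel₀ (mul_pos two_pos hk0).ne' ?_
    linear_combination hweighted

/-- Cayley's formula. -/
theorem card_treesAbove_bot [Nonempty V] :
    (Fintype.card V : ℝ) ^ 2 * (⊥ : SimpleGraph V).treesAbove.card =
      (Fintype.card V : ℝ) ^ Fintype.card V := by
  have h := (isAcyclic_bot (V := V)).ncard_edgeSet_add_card_connectedComponent
  rw [edgeSet_bot, Set.ncard_empty, zero_add] at h
  rw [isAcyclic_bot.sq_mul_card_treesAbove, h]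
  suffices (⊥ : SimpleGraph V).componentProd = 1 by rw [this, Nat.cast_one, mul_one]
  refine Finset.prod_eq_one fun c _ => ?_
  induction c using ConnectedComponent.ind with | _ x =>
  change componentSize _ x = 1
  rw [componentSize_eq_card]
  simp [reachable_bot, Finset.filter_eq]

theorem componentProd_le (G : SimpleGraph V) [Nonempty V] :
    (G.componentProd : ℝ) ≤
      ((Fintype.card V : ℝ) / Nat.card G.ConnectedComponent) ^ Nat.card G.ConnectedComponent := by
  have hk : (0 : ℝ) < Fintype.card G.ConnectedComponent := mod_cast Fintype.card_pos
  have hsum : ∑ c : G.ConnectedComponent, (c.supp.ncard : ℝ) = Fintype.card V := by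
    rw [← Finset.card_univ, Finset.card_eq_sum_card_fiberwise (f := G.connectedComponentMk)
      (t := Finset.univ) (by simp), Nat.cast_sum]
    refine Finset.sum_congr rfl fun c _ => ?_
    rw [Set.ncard_eq_toFinset_card']
    congr 2
    ext w
    simp
  have h := Real.geom_mean_le_arith_mean Finset.univ (fun _ : G.ConnectedComponent => (1 : ℝ))
    (fun c => (c.supp.ncard : ℝ)) (fun _ _ => zero_le_one) (by simpa using hk)
    (fun _ _ => Nat.cast_nonneg _)
  simp only [Real.rpow_one, one_mul, hsum, Finset.sum_const, Finset.card_univ, nsmul_eq_mul,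
    mul_one] at h
  rw [Nat.card_eq_fintype_card, componentProd, Nat.cast_prod]
  have hp : (0 : ℝ) ≤ ∏ c : G.ConnectedComponent, (c.supp.ncard : ℝ) :=
    Finset.prod_nonneg fun _ _ => Nat.cast_nonneg _
  have := pow_le_pow_left₀ (Real.rpow_nonneg hp _) h (Fintype.card G.ConnectedComponent)
  rwa [Real.rpow_inv_natCast_pow hp Fintype.card_ne_zero] at this

end Finite

end SimpleGraph

section TreeCode

open scoped Classical

theorem exists_isTreeCode_card_eq_A (n d : ℕ) : ∃ C, IsTreeCode n d C ∧ C.card = A n d := by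
  have hne : {m : ℕ | ∃ C : Finset (SimpleGraph (Fin n)),
      IsTreeCode n d C ∧ C.card = m}.Nonempty := ⟨0, ∅, by simp [IsTreeCode]⟩
  refine Nat.sSup_mem hne ⟨Fintype.card (SimpleGraph (Fin n)), ?_⟩
  rintro m ⟨C, -, rfl⟩
  exact Finset.card_le_univ C

theorem IsTreeCode.card_le_A {n d : ℕ} {C : Finset (SimpleGraph (Fin n))}
    (hC : IsTreeCode n d C) : C.card ≤ A n d := by
  refine le_csSup ⟨Fintype.card (SimpleGraph (Fin n)), ?_⟩ ⟨C, hC, rfl⟩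
  rintro m ⟨C, -, rfl⟩
  exact Finset.card_le_univ C

theorem treeDist_comm {n : ℕ} (G H : SimpleGraph (Fin n)) : treeDist G H = treeDist H G := by
  rw [treeDist, treeDist, Set.inter_comm]

/-- In a largest code, every tree is close to some codeword. -/
theorem exists_covering_treeCode (n d : ℕ) :
    ∃ C : Finset (SimpleGraph (Fin n)), C.card = A n d ∧ (∀ G ∈ C, G.IsTree) ∧
      ∀ T : SimpleGraph (Fin n), T.IsTree → ∃ G ∈ C, T = G ∨ treeDist G T < d := by
  obtain ⟨C, hC, hcard⟩ := exists_isTreeCode_card_eq_A n d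
  refine ⟨C, hcard, hC.1, fun T hT => ?_⟩
  by_contra! hfar
  have hmem : T ∉ C := fun h => (hfar T h).1 rfl
  have hins : IsTreeCode n d (insert T C) := by
    refine ⟨fun G hG => ?_, fun G hG H hH hne => ?_⟩
    · rcases Finset.mem_insert.1 hG with rfl | hG
      · exact hT
      · exact hC.1 G hG
    · rcases Finset.mem_insert.1 hG with rfl | hG' <;> rcases Finset.mem_insert.1 hH with rfl | hH'
      · exact (hne rfl).elim
      · exact treeDist_comm G H ▸ (hfar H hH').2
      · exact (hfar G hG').2
      · exact hC.2 G hG' H hH' hne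
  have := hins.card_le_A
  rw [Finset.card_insert_of_notMem hmem] at this
  omega

theorem sq_mul_card_treesAbove_fromEdgeSet_le {n d : ℕ} (hd : d < n) {G : SimpleGraph (Fin n)}
    (hG : G.IsTree) {S : Finset (Sym2 (Fin n))} (hS : S ⊆ G.edgeFinset) (hcard : S.card = n - d) :
    (n : ℝ) ^ 2 * (SimpleGraph.fromEdgeSet (S : Set (Sym2 (Fin n)))).treesAbove.card ≤
      (n : ℝ) ^ d * (n / d) ^ d := by
  have : Nonempty (Fin n) := ⟨⟨0, by omega⟩⟩
  have hSG : (S : Set (Sym2 (Fin n))) ⊆ G.edgeSet := fun e he => by simpa using hS he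
  have hac : (SimpleGraph.fromEdgeSet (S : Set (Sym2 (Fin n)))).IsAcyclic :=
    hG.isAcyclic.anti (by simpa using SimpleGraph.fromEdgeSet_mono hSG)
  have hcomp := hac.ncard_edgeSet_add_card_connectedComponent
  have hedge : (SimpleGraph.fromEdgeSet (S : Set (Sym2 (Fin n)))).edgeSet = S := by
    rw [SimpleGraph.edgeSet_fromEdgeSet, sdiff_eq_left, Set.disjoint_left]
    exact fun e he => G.not_isDiag_of_mem_edgeSet (hSG he)
  rw [hedge, Set.ncard_coe_finset, hcard, Fintype.card_fin] at hcomp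
  have hk : Nat.card (SimpleGraph.fromEdgeSet (S : Set (Sym2 (Fin n)))).ConnectedComponent = d := by
    omega
  have h₁ := hac.sq_mul_card_treesAbove
  have h₂ := (SimpleGraph.fromEdgeSet (S : Set (Sym2 (Fin n)))).componentProd_le
  rw [hk, Fintype.card_fin] at h₁ h₂
  rw [h₁]
  gcongr

theorem sq_mul_card_ball_le {n d : ℕ} (hd1 : 1 ≤ d) (hd : d < n) {G : SimpleGraph (Fin n)}
    (hG : G.IsTree) :
    (n : ℝ) ^ 2 * (Finset.univ.filter fun T : SimpleGraph (Fin n) =>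
        T.IsTree ∧ (T = G ∨ treeDist G T < d)).card ≤
      n.choose d * ((n : ℝ) ^ d * (n / d) ^ d) := by
  have hedges : G.edgeFinset.card = n - 1 := by
    have := hG.card_edgeFinset
    rw [Fintype.card_fin] at this
    omega
  have hsub : (Finset.univ.filter fun T : SimpleGraph (Fin n) =>
      T.IsTree ∧ (T = G ∨ treeDist G T < d)) ⊆
      (G.edgeFinset.powersetCard (n - d)).biUnion fun S =>
        (SimpleGraph.fromEdgeSet (S : Set (Sym2 (Fin n)))).treesAbove := by
    intro T hT
    simp only [Finset.mem_filter, Finset.mem_univ, true_and] at hT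
    obtain ⟨hT, hclose⟩ := hT
    have hcommon : n - d ≤ (G.edgeFinset ∩ T.edgeFinset).card := by
      rcases hclose with rfl | hlt
      · rw [Finset.inter_self]
        omega
      · rw [treeDist] at hlt
        have : (G.edgeSet ∩ T.edgeSet).ncard = (G.edgeFinset ∩ T.edgeFinset).card := by
          rw [← Set.ncard_coe_finset]
          simp
        omega
    obtain ⟨S, hS, hcard⟩ := Finset.exists_subset_card_eq hcommon
    refine Finset.mem_biUnion.2 ⟨S, Finset.mem_powersetCard.2
      ⟨hS.trans Finset.inter_subset_left, hcard⟩, SimpleGraph.mem_treesAbove.2 ⟨hT, ?_⟩⟩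
    have hST : (S : Set (Sym2 (Fin n))) ⊆ T.edgeSet := fun e he => by
      simpa using Finset.inter_subset_right (hS he)
    simpa using SimpleGraph.fromEdgeSet_mono hST
  have hcount : (G.edgeFinset.powersetCard (n - d)).card ≤ n.choose d := by
    rw [Finset.card_powersetCard, hedges, ← Nat.choose_symm hd.le]
    exact Nat.choose_le_choose _ (Nat.sub_le n 1)
  calc (n : ℝ) ^ 2 * (Finset.univ.filter fun T : SimpleGraph (Fin n) =>
          T.IsTree ∧ (T = G ∨ treeDist G T < d)).card
      ≤ (n : ℝ) ^ 2 * ∑ S ∈ G.edgeFinset.powersetCard (n - d),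
          ((SimpleGraph.fromEdgeSet (S : Set (Sym2 (Fin n)))).treesAbove.card : ℝ) := by
        gcongr
        exact_mod_cast (Finset.card_le_card hsub).trans Finset.card_biUnion_le
    _ ≤ ∑ S ∈ G.edgeFinset.powersetCard (n - d), ((n : ℝ) ^ d * (n / d) ^ d) := by
        rw [Finset.mul_sum]
        refine Finset.sum_le_sum fun S hS => ?_
        rw [Finset.mem_powersetCard] at hS
        exact sq_mul_card_treesAbove_fromEdgeSet_le hd hG hS.1 hS.2
    _ ≤ n.choose d * ((n : ℝ) ^ d * (n / d) ^ d) := by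
        rw [Finset.sum_const, nsmul_eq_mul]
        gcongr

/-- The Gilbert–Varshamov bound for tree-codes. -/
theorem pow_le_A_mul {n d : ℕ} (hd1 : 1 ≤ d) (hd : d < n) :
    (n : ℝ) ^ n ≤ A n d * (n.choose d * ((n : ℝ) ^ d * (n / d) ^ d)) := by
  have : Nonempty (Fin n) := ⟨⟨0, by omega⟩⟩
  obtain ⟨C, hcard, htree, hcover⟩ := exists_covering_treeCode n d
  have hsub : (⊥ : SimpleGraph (Fin n)).treesAbove ⊆ C.biUnion fun G =>
      Finset.univ.filter fun T : SimpleGraph (Fin n) =>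
        T.IsTree ∧ (T = G ∨ treeDist G T < d) := by
    intro T hT
    have hT := (SimpleGraph.mem_treesAbove.1 hT).1
    obtain ⟨G, hG, hclose⟩ := hcover T hT
    exact Finset.mem_biUnion.2 ⟨G, hG, by simp [hT, hclose]⟩
  have hcayley := SimpleGraph.card_treesAbove_bot (V := Fin n)
  rw [Fintype.card_fin] at hcayley
  calc (n : ℝ) ^ n = (n : ℝ) ^ 2 * (⊥ : SimpleGraph (Fin n)).treesAbove.card := hcayley.symm
    _ ≤ (n : ℝ) ^ 2 * ∑ G ∈ C, ((Finset.univ.filter fun T : SimpleGraph (Fin n) =>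
        T.IsTree ∧ (T = G ∨ treeDist G T < d)).card : ℝ) := by
        gcongr
        exact_mod_cast (Finset.card_le_card hsub).trans Finset.card_biUnion_le
    _ ≤ ∑ G ∈ C, (n.choose d * ((n : ℝ) ^ d * (n / d) ^ d)) := by
        rw [Finset.mul_sum]
        exact Finset.sum_le_sum fun G hG => sq_mul_card_ball_le hd1 hd (htree G hG)
    _ = A n d * (n.choose d * ((n : ℝ) ^ d * (n / d) ^ d)) := by
        rw [Finset.sum_const, nsmul_eq_mul, hcard]

end TreeCode

theorem Nat.choose_le_exp_mul_div_pow (n : ℕ) {d : ℕ} (hd : 1 ≤ d) :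
    (n.choose d : ℝ) ≤ (Real.exp 1 * n / d) ^ d := by
  have hd0 : (0 : ℝ) < d := mod_cast hd
  have hfac : (0 : ℝ) < d.factorial := mod_cast d.factorial_pos
  have h := Real.pow_div_factorial_le_exp (d : ℝ) hd0.le d
  rw [div_le_iff₀ hfac] at h
  refine (Nat.choose_le_pow_div (α := ℝ) d n).trans ?_
  rw [div_pow, mul_pow, ← Real.exp_nat_mul, mul_one, div_le_div_iff₀ hfac (by positivity)]
  calc (n : ℝ) ^ d * d ^ d ≤ n ^ d * (Real.exp d * d.factorial) := by gcongr
    _ = _ := by ring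

theorem stmt15 (n d : ℕ) (hd1 : 1 ≤ d) (hd2 : d < n) :
    (((d : ℝ) ^ 2 / (Real.exp 1 * (n : ℝ) ^ 2)) ^ d * (n : ℝ) ^ (n - d) ≤ (A n d : ℝ)) ∧
      (2 * Real.sqrt n ≤ (d : ℝ) →
        (4 / Real.exp 1) ^ d * (n : ℝ) ^ ((n : ℤ) - 2 * d) ≤ (A n d : ℝ)) := by
  have hd0 : (0 : ℝ) < d := mod_cast hd1
  have hn0 : (0 : ℝ) < n := mod_cast (Nat.zero_le d).trans_lt hd2
  have he := Real.exp_pos 1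
  have hfirst : ((d : ℝ) ^ 2 / (Real.exp 1 * (n : ℝ) ^ 2)) ^ d * (n : ℝ) ^ (n - d) ≤ A n d := by
    have hgv : (n : ℝ) ^ n ≤
        A n d * ((Real.exp 1 * n / d) ^ d * ((n : ℝ) ^ d * (n / d) ^ d)) :=
      (pow_le_A_mul hd1 hd2).trans (by
        gcongr
        exact Nat.choose_le_exp_mul_div_pow n hd1)
    rw [← div_le_iff₀ (by positivity)] at hgv
    refine le_of_eq_of_le ?_ hgv
    rw [eq_div_iff (by positivity)]
    calc ((d : ℝ) ^ 2 / (Real.exp 1 * (n : ℝ) ^ 2)) ^ d * (n : ℝ) ^ (n - d) *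
          ((Real.exp 1 * n / d) ^ d * ((n : ℝ) ^ d * (n / d) ^ d))
        = ((d : ℝ) ^ 2 / (Real.exp 1 * (n : ℝ) ^ 2) * (Real.exp 1 * n / d) * (n / d)) ^ d *
          ((n : ℝ) ^ (n - d) * (n : ℝ) ^ d) := by
          rw [mul_pow, mul_pow]
          ring
      _ = (n : ℝ) ^ n := by
          rw [← pow_add, Nat.sub_add_cancel hd2.le]
          have : (d : ℝ) ^ 2 / (Real.exp 1 * (n : ℝ) ^ 2) * (Real.exp 1 * n / d) * (n / d) = 1 := by
            field_simp
          rw [this, one_pow, one_mul]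
  refine ⟨hfirst, fun hsqrt => le_trans ?_ hfirst⟩
  have hsq : 4 * (n : ℝ) ≤ d ^ 2 := by
    have := pow_le_pow_left₀ (by positivity) hsqrt 2
    rw [mul_pow, Real.sq_sqrt hn0.le] at this
    linarith
  have hz : (n : ℝ) ^ ((n : ℤ) - 2 * d) = (n : ℝ) ^ (n - d) / (n : ℝ) ^ d := by
    rw [← zpow_natCast, ← zpow_natCast, ← zpow_sub₀ hn0.ne']
    congr 1
    omega
  rw [hz, mul_div_assoc', mul_div_right_comm, ← div_pow]
  refine mul_le_mul_of_nonneg_right (pow_le_pow_left₀ (by positivity) ?_ d) (by positivity)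
  rw [div_div, div_le_div_iff₀ (by positivity) (by positivity)]
  calc 4 * (Real.exp 1 * (n : ℝ) ^ 2) = 4 * n * (Real.exp 1 * n) := by ring
    _ ≤ d ^ 2 * (Real.exp 1 * n) := by gcongr
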